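/- arXiv:2410.00529 — 3 statements merged into one kernel-verified Lean document; each statement's English description precedes it below -/
import Mathlib

section
/- For every j ≥ 0 and k ≥ 1, the following limits exist with the stated values: lim_{n→∞} F_k^j(n)/n = α_k^j; lim_{n→∞} L_k^j(n)/n = β_k^j; for 1 ≤ i < k, lim_{n→∞} C_k^{(=i)}(n)/n = α_k^{k+i-1}; and lim_{n→∞} C_k^{(=k)}(n)/n = α_k^{k-1} = β_k - 1. -/
/-- The substitution τ_k, applied to a single letter: τ_k(k) = k1 and τ_k(i) = i+1 for i ≠ k. -/
def tauLetter (k i : ℕ) : List ℕ := if i = k then [k, 1] else [i + 1]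

/-- The substitution τ_k, extended to finite words (lists of letters) by concatenation. -/
def tauWord (k : ℕ) (w : List ℕ) : List ℕ := w.flatMap (tauLetter k)

/-- The infinite fixed point x_k of τ_k (starting with the letter k): its n-th letter is the
n-th letter of any sufficiently long iterate τ_k^j(k), here j = n+1. -/
def xk (k n : ℕ) : ℕ := ((tauWord k)^[n + 1] [k]).getD n 0

/-- L_k(n) = |τ_k(x_k[0:n))|, the length of the τ_k-image of the prefix of x_k of length n. -/
def Lk (k n : ℕ) : ℕ := (tauWord k ((List.range n).map (xk k))).length

/-- C_k^{(=i)}(n): the number of occurrences of the letter i among x_k[0],...,x_k[n-1]. -/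
def Ceq (k i n : ℕ) : ℕ := ((Finset.range n).filter (fun m => xk k m = i)).card

/-- C_k^{(>j)}(n): the number of positions m < n with x_k[m] > j. -/
def Cgt (k j n : ℕ) : ℕ := ((Finset.range n).filter (fun m => j < xk k m)).card

/-- The prefix of length `n` of the word `x_k`. -/
def xkPrefix (k n : ℕ) : List ℕ := (List.range n).map (xk k)

/-! ### The fixed point of the substitution -/

theorem tauWord_append (k : ℕ) (u v : List ℕ) :
    tauWord k (u ++ v) = tauWord k u ++ tauWord k v := List.flatMap_append

theorem tauWord_cons (k i : ℕ) (w : List ℕ) :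
    tauWord k (i :: w) = tauLetter k i ++ tauWord k w := List.flatMap_cons

theorem tauWord_prefix {k : ℕ} {u v : List ℕ} (h : u <+: v) : tauWord k u <+: tauWord k v := by
  obtain ⟨t, rfl⟩ := h
  exact ⟨tauWord k t, (tauWord_append k u t).symm⟩

theorem length_tauWord (k : ℕ) (w : List ℕ) : (tauWord k w).length = w.length + w.count k := by
  induction w with
  | nil => rfl
  | cons i w ih =>
    rw [tauWord_cons, List.length_append, ih, tauLetter, List.length_cons, List.count_cons]
    split_ifs <;> simp_all <;> omega

theorem tauWord_iterate_prefix_succ (k j : ℕ) :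
    (tauWord k)^[j] [k] <+: (tauWord k)^[j + 1] [k] := by
  induction j with
  | zero => simp [tauWord, tauLetter]
  | succ j ih =>
    rw [Function.iterate_succ_apply', Function.iterate_succ_apply' _ (j + 1)]
    exact tauWord_prefix ih

theorem tauWord_iterate_prefix (k : ℕ) {i j : ℕ} (h : i ≤ j) :
    (tauWord k)^[i] [k] <+: (tauWord k)^[j] [k] := by
  induction h with
  | refl => exact List.prefix_rfl
  | step _ ih => exact ih.trans (tauWord_iterate_prefix_succ k _)

theorem lt_length_tauWord_iterate (k j : ℕ) : j < ((tauWord k)^[j] [k]).length := by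
  induction j with
  | zero => simp
  | succ j ih =>
    rw [Function.iterate_succ_apply', length_tauWord]
    have h : 0 < ((tauWord k)^[j] [k]).count k := by
      rw [List.count_pos_iff]
      exact (tauWord_iterate_prefix k (Nat.zero_le j)).subset (by simp)
    omega

theorem xk_eq_getElem (k : ℕ) {n j : ℕ} (h : n < ((tauWord k)^[j] [k]).length) :
    xk k n = ((tauWord k)^[j] [k])[n] := by
  have h1 : n < ((tauWord k)^[n + 1] [k]).length :=
    (Nat.lt_succ_self n).trans (lt_length_tauWord_iterate k (n + 1))
  rw [xk, List.getD_eq_getElem _ _ h1]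
  rcases le_total (n + 1) j with hj | hj
  · exact (tauWord_iterate_prefix k hj).getElem h1
  · exact ((tauWord_iterate_prefix k hj).getElem h).symm

theorem length_xkPrefix (k n : ℕ) : (xkPrefix k n).length = n := by simp [xkPrefix]

theorem xkPrefix_succ (k n : ℕ) : xkPrefix k (n + 1) = xkPrefix k n ++ [xk k n] := by
  simp [xkPrefix, List.range_succ]

theorem xkPrefix_eq_of_prefix (k j : ℕ) {w : List ℕ} (h : w <+: (tauWord k)^[j] [k]) :
    xkPrefix k w.length = w := by
  apply List.ext_getElem (length_xkPrefix k _)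
  intro n h1 h2
  rw [h.getElem h2, ← xk_eq_getElem k (h2.trans_le h.length_le)]
  simp [xkPrefix]

theorem xkPrefix_prefix (k n : ℕ) : xkPrefix k n <+: (tauWord k)^[n] [k] := by
  have h := lt_length_tauWord_iterate k n
  have h2 := xkPrefix_eq_of_prefix k n (List.take_prefix n ((tauWord k)^[n] [k]))
  rw [List.length_take, min_eq_left h.le] at h2
  rw [h2]
  exact List.take_prefix _ _

theorem tauWord_xkPrefix (k n : ℕ) : tauWord k (xkPrefix k n) = xkPrefix k (Lk k n) := by
  have h := tauWord_prefix (k := k) (xkPrefix_prefix k n)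
  rw [← Function.iterate_succ_apply' (tauWord k)] at h
  exact (xkPrefix_eq_of_prefix k (n + 1) h).symm

theorem tauWord_iterate_xkPrefix (k j n : ℕ) :
    (tauWord k)^[j] (xkPrefix k n) = xkPrefix k ((Lk k)^[j] n) := by
  induction j with
  | zero => rfl
  | succ j ih => rw [Function.iterate_succ_apply', ih, tauWord_xkPrefix, Function.iterate_succ_apply']

theorem mem_tauWord_iterate {k : ℕ} (hk : 1 ≤ k) (j : ℕ) :
    ∀ i ∈ (tauWord k)^[j] [k], 1 ≤ i ∧ i ≤ k := by
  induction j with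
  | zero => simpa using hk
  | succ j ih =>
    intro i hi
    rw [Function.iterate_succ_apply'] at hi
    obtain ⟨a, ha, hi⟩ := List.mem_flatMap.1 hi
    have := ih a ha
    unfold tauLetter at hi
    split_ifs at hi <;> simp at hi <;> omega

theorem xk_mem_Icc {k : ℕ} (hk : 1 ≤ k) (n : ℕ) : 1 ≤ xk k n ∧ xk k n ≤ k := by
  rw [xk_eq_getElem k (lt_length_tauWord_iterate k n)]
  exact mem_tauWord_iterate hk n _ (List.getElem_mem _)

theorem one_le_of_mem_xkPrefix {k : ℕ} (hk : 1 ≤ k) {n i : ℕ} (h : i ∈ xkPrefix k n) : 1 ≤ i := by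
  obtain ⟨m, -, rfl⟩ := List.mem_map.1 h
  exact (xk_mem_Icc hk m).1

theorem Ceq_succ (k i n : ℕ) : Ceq k i (n + 1) = Ceq k i n + if xk k n = i then 1 else 0 := by
  simp only [Ceq, Finset.card_filter, Finset.sum_range_succ]

theorem Ceq_eq_count (k i n : ℕ) : Ceq k i n = (xkPrefix k n).count i := by
  induction n with
  | zero => simp [Ceq, xkPrefix]
  | succ n ih =>
    rw [xkPrefix_succ, List.count_append, Ceq_succ, ih]
    simp [List.count_singleton]

theorem Ceq_mono (k i : ℕ) : Monotone (Ceq k i) :=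
  monotone_nat_of_le_succ fun n => by rw [Ceq_succ]; omega

theorem Ceq_succ_le (k i n : ℕ) : Ceq k i (n + 1) ≤ Ceq k i n + 1 := by
  rw [Ceq_succ]; split_ifs <;> omega

theorem Lk_eq (k n : ℕ) : Lk k n = n + Ceq k k n := by
  have h := length_tauWord k (xkPrefix k n)
  rw [length_xkPrefix, ← Ceq_eq_count] at h
  exact h

theorem Lk_zero (k : ℕ) : Lk k 0 = 0 := rfl

theorem Lk_strictMono (k : ℕ) : StrictMono (Lk k) := fun m n h => by
  have := Ceq_mono k k h.le
  rw [Lk_eq, Lk_eq]; omega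

theorem Lk_succ_le (k n : ℕ) : Lk k (n + 1) ≤ Lk k n + 2 := by
  have := Ceq_succ_le k k n
  rw [Lk_eq, Lk_eq]; omega

/-- The letter at the start of the image of the `n`-th letter. -/
theorem xk_Lk (k n : ℕ) : xk k (Lk k n) = if xk k n = k then k else xk k n + 1 := by
  have h := tauWord_xkPrefix k (n + 1)
  rw [xkPrefix_succ, tauWord_append, tauWord_xkPrefix] at h
  have hlt : Lk k n < (xkPrefix k (Lk k (n + 1))).length := by
    rw [length_xkPrefix]; exact Lk_strictMono k (Nat.lt_succ_self n)
  have h1 : (xkPrefix k (Lk k (n + 1)))[Lk k n] = xk k (Lk k n) := by simp [xkPrefix]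
  rw [← h1]
  simp only [← h]
  rw [List.getElem_append_right (length_xkPrefix k _).le]
  simp only [length_xkPrefix, tauWord, List.flatMap_singleton, Nat.sub_self]
  unfold tauLetter
  split_ifs <;> simp [*]

theorem le_xk_iterate_Lk {k : ℕ} (hk : 1 ≤ k) (q : ℕ) {j : ℕ} (hj : j + 1 ≤ k) :
    j + 1 ≤ xk k ((Lk k)^[j] q) := by
  induction j with
  | zero => exact (xk_mem_Icc hk q).1
  | succ j ih =>
    have := ih (by omega)
    rw [Function.iterate_succ_apply', xk_Lk]
    split_ifs <;> omega

theorem xk_iterate_Lk_pred {k : ℕ} (hk : 1 ≤ k) (q : ℕ) : xk k ((Lk k)^[k - 1] q) = k := by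
  have h1 := le_xk_iterate_Lk hk q (j := k - 1) (by omega)
  have h2 := (xk_mem_Icc hk ((Lk k)^[k - 1] q)).2
  omega

theorem countP_tauWord {k j : ℕ} (hj : 2 ≤ j) (hjk : j ≤ k) (w : List ℕ) :
    (tauWord k w).countP (j ≤ ·) = w.countP (j - 1 ≤ ·) := by
  induction w with
  | nil => rfl
  | cons i w ih =>
    rw [tauWord_cons, List.countP_append, ih, tauLetter, List.countP_cons]
    simp only [decide_eq_true_eq]
    split_ifs <;> simp only [List.countP_cons, List.countP_nil, decide_eq_true_eq] <;>
      split_ifs <;> omega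

theorem countP_tauWord_iterate {k j : ℕ} (hj : j + 1 ≤ k) (w : List ℕ) :
    ((tauWord k)^[j] w).countP (k ≤ ·) = w.countP (k - j ≤ ·) := by
  induction j generalizing w with
  | zero => rfl
  | succ j ih =>
    rw [Function.iterate_succ_apply, ih (by omega), countP_tauWord (by omega) (by omega)]
    rfl

theorem Ceq_iterate_Lk_pred {k : ℕ} (hk : 1 ≤ k) (q : ℕ) : Ceq k k ((Lk k)^[k - 1] q) = q := by
  have h := countP_tauWord_iterate (k := k) (j := k - 1) (by omega) (xkPrefix k q)
  rw [tauWord_iterate_xkPrefix, show k - (k - 1) = 1 by omega] at h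
  have h1 : (xkPrefix k q).countP (1 ≤ ·) = q := by
    rw [List.countP_eq_length.2 (fun i hi => by simpa using one_le_of_mem_xkPrefix hk hi),
      length_xkPrefix]
  rw [h1] at h
  rw [Ceq_eq_count, List.count]
  refine Eq.trans ?_ h
  apply List.countP_congr
  intro i hi
  obtain ⟨m, -, rfl⟩ := List.mem_map.1 hi
  have := (xk_mem_Icc hk m).2
  simp
  omega

theorem Ceq_iterate_Lk_pred_succ {k : ℕ} (hk : 1 ≤ k) (q : ℕ) :
    Ceq k k ((Lk k)^[k - 1] q + 1) = q + 1 := by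
  rw [Ceq_succ, Ceq_iterate_Lk_pred hk, xk_iterate_Lk_pred hk, if_pos rfl]

theorem iterate_Lk_self {k : ℕ} (hk : 1 ≤ k) (q : ℕ) :
    (Lk k)^[k] q = (Lk k)^[k - 1] q + q := by
  obtain ⟨k, rfl⟩ : ∃ i, k = i + 1 := ⟨k - 1, by omega⟩
  rw [Function.iterate_succ_apply', Lk_eq]
  exact congrArg _ (Ceq_iterate_Lk_pred hk q)

theorem Ceq_one_Lk {k : ℕ} (hk : 2 ≤ k) (n : ℕ) : Ceq k 1 (Lk k n) = Ceq k k n := by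
  rw [Ceq_eq_count, Ceq_eq_count, ← tauWord_xkPrefix]
  have h : ∀ i ∈ xkPrefix k n, 1 ≤ i := fun i => one_le_of_mem_xkPrefix (by omega)
  generalize xkPrefix k n = w at h
  induction w with
  | nil => rfl
  | cons i w ih =>
    rw [List.forall_mem_cons] at h
    have hk1 : k ≠ 1 := by omega
    rw [tauWord_cons, List.count_append, ih h.2, tauLetter, List.count_cons]
    split_ifs <;> simp_all [List.count_cons] <;> omega

theorem Ceq_succ_Lk {k i : ℕ} (hi : 1 ≤ i) (hik : i + 1 < k) (n : ℕ) :
    Ceq k (i + 1) (Lk k n) = Ceq k i n := by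
  rw [Ceq_eq_count, Ceq_eq_count, ← tauWord_xkPrefix]
  induction xkPrefix k n with
  | nil => rfl
  | cons a w ih =>
    rw [tauWord_cons, List.count_append, ih, tauLetter, List.count_cons]
    split_ifs <;> simp_all [List.count_cons] <;> omega

/-! ### The recursive function as lower adjoint of `L_k` -/

/-- The lower adjoint of `L_k`: the least `m` with `n ≤ L_k(m)`. -/
noncomputable def LkAdjoint (k n : ℕ) : ℕ := sInf {m | n ≤ Lk k m}

theorem gc_LkAdjoint (k : ℕ) : GaloisConnection (LkAdjoint k) (Lk k) := by
  intro n m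
  constructor
  · intro h
    have h1 : n ≤ Lk k (LkAdjoint k n) :=
      Nat.sInf_mem (s := {m | n ≤ Lk k m}) ⟨n, (Lk_strictMono k).id_le n⟩
    exact h1.trans ((Lk_strictMono k).monotone h)
  · exact fun h => Nat.sInf_le h

theorem GaloisConnection.iterate_nat {f g : ℕ → ℕ} (h : GaloisConnection f g) (j : ℕ) :
    GaloisConnection f^[j] g^[j] := by
  induction j with
  | zero => exact GaloisConnection.id
  | succ j ih =>
    rw [Function.iterate_succ', Function.iterate_succ]
    exact ih.compose h

theorem LkAdjoint_le (k n : ℕ) : LkAdjoint k n ≤ n :=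
  (gc_LkAdjoint k).l_le ((Lk_strictMono k).id_le n)

theorem LkAdjoint_succ {k : ℕ} (hk : 1 ≤ k) (n : ℕ) :
    LkAdjoint k (n + 1) = n + 1 - (LkAdjoint k)^[k] n := by
  have gc := (gc_LkAdjoint k).iterate_nat k
  set q := (LkAdjoint k)^[k] n
  have h1 : n ≤ (Lk k)^[k] q := gc.le_u_l n
  rw [iterate_Lk_self hk] at h1
  have hC : Ceq k k (n - q) ≤ q := by
    have := Ceq_mono k k (show n - q ≤ (Lk k)^[k - 1] q by omega)
    rwa [Ceq_iterate_Lk_pred hk] at this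
  have hC' : q ≤ n ∧ q ≤ Ceq k k (n - q + 1) := by
    rcases Nat.eq_zero_or_pos q with h0 | h0
    · omega
    · have h2 : ¬ n ≤ (Lk k)^[k] (q - 1) := fun h => by
        have := gc.l_le h
        omega
      rw [iterate_Lk_self hk] at h2
      have := Ceq_mono k k (show (Lk k)^[k - 1] (q - 1) + 1 ≤ n - q + 1 by omega)
      rw [Ceq_iterate_Lk_pred_succ hk] at this
      omega
  apply le_antisymm
  · apply (gc_LkAdjoint k).l_le
    rw [show n + 1 - q = n - q + 1 by omega, Lk_eq]
    omega
  · have h3 : ¬ LkAdjoint k (n + 1) ≤ n - q := fun h => by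
      have := (gc_LkAdjoint k).le_u h
      rw [Lk_eq] at this
      omega
    omega

theorem iterate_eq_of_eq_on_le {f g : ℕ → ℕ} {n : ℕ} (h : ∀ m ≤ n, f m = g m)
    (hg : ∀ m, g m ≤ m) (j : ℕ) : f^[j] n = g^[j] n ∧ g^[j] n ≤ n := by
  induction j with
  | zero => simp
  | succ j ih =>
    rw [Function.iterate_succ_apply', Function.iterate_succ_apply', ih.1]
    exact ⟨h _ ih.2, (hg _).trans ih.2⟩

theorem eq_LkAdjoint {k : ℕ} (hk : 1 ≤ k) {F : ℕ → ℕ} (hF0 : F 0 = 0)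
    (hF : ∀ n, 1 ≤ n → F n = n - F^[k] (n - 1)) : F = LkAdjoint k := by
  funext n
  induction n using Nat.strong_induction_on with
  | _ n ih =>
    rcases n with _ | n
    · have := LkAdjoint_le k 0
      omega
    · rw [hF _ (by omega), LkAdjoint_succ hk, Nat.add_sub_cancel,
        (iterate_eq_of_eq_on_le (fun m hm => ih m (by omega)) (LkAdjoint_le k) k).1]

theorem LkAdjoint_succ_le (k n : ℕ) : LkAdjoint k (n + 1) ≤ LkAdjoint k n + 1 := by
  apply (gc_LkAdjoint k).l_le
  have h1 := (gc_LkAdjoint k).le_u_l n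
  have h2 := Lk_strictMono k (lt_add_one (LkAdjoint k n))
  omega

theorem LkAdjoint_iterate_succ_le (k j n : ℕ) :
    (LkAdjoint k)^[j] (n + 1) ≤ (LkAdjoint k)^[j] n + 1 := by
  induction j with
  | zero => simp
  | succ j ih =>
    rw [Function.iterate_succ_apply', Function.iterate_succ_apply']
    exact ((gc_LkAdjoint k).monotone_l ih).trans (LkAdjoint_succ_le k _)

theorem LkAdjoint_iterate_Lk_iterate (k j n : ℕ) : (LkAdjoint k)^[j] ((Lk k)^[j] n) = n :=
  ((Lk_strictMono k).injective.iterate j) (((gc_LkAdjoint k).iterate_nat j).u_l_u_eq_u n)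

/-! ### Asymptotics -/

open Filter Topology

theorem le_root_of_recurrence {k : ℕ} {z : ℕ → ℝ} (h0 : z 0 = 1) (hz : ∀ j, 0 ≤ z j)
    (hrec : ∀ j, z j = z (j + 1) + z (j + k)) : ∃ c, c + c ^ k ≤ 1 ∧ 0 ≤ c ∧ z 1 ≤ c := by
  have hanti : ∀ j, z (j + 1) ≤ z j := fun j => by linarith [hrec j, hz (j + k)]
  set S : Set ℝ := {c | ∀ j, z (j + 1) ≤ c * z j} with hS
  have hlow : ∀ c ∈ S, z 1 ≤ c := fun c hc => by simpa [h0] using hc 0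
  have hbdd : BddBelow S := ⟨z 1, hlow⟩
  have h1S : (1 : ℝ) ∈ S := fun j => by simpa using hanti j
  set c := sInf S
  have hzc : z 1 ≤ c := le_csInf ⟨1, h1S⟩ hlow
  have hc0 : 0 ≤ c := (hz 1).trans hzc
  have hc1 : c ≤ 1 := csInf_le hbdd h1S
  have hcS : ∀ j, 0 ≤ c * z j - z (j + 1) := by
    intro j
    rw [sub_nonneg]
    rcases (hz j).eq_or_lt with h | h
    · have := hanti j
      rw [← h] at this ⊢
      linarith
    · rw [← div_le_iff₀ h]
      exact le_csInf ⟨1, h1S⟩ fun d hd => by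
        rw [div_le_iff₀ h]
        exact hd j
  have hg : ∀ j i, c * z (j + i) - z (j + i + 1) ≤ c * z j - z (j + 1) := by
    intro j i
    induction i with
    | zero => exact le_rfl
    | succ i ih =>
      refine le_trans ?_ ih
      have h1 := hrec (j + i)
      have h2 := hrec (j + i + 1)
      have h3 := hcS (j + i + k)
      rw [show j + i + 1 + k = j + i + k + 1 by ring] at h2
      rw [← add_assoc]
      linear_combination h3 - c * h1 + h2
  refine ⟨c, ?_, hc0, hzc⟩
  refine le_of_forall_pos_le_add fun δ hδ => ?_
  obtain ⟨ε, hε, hεδ⟩ : ∃ ε : ℝ, 0 < ε ∧ (k + 1) * ε = δ :=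
    ⟨δ / (k + 1), by positivity, by field_simp⟩
  have hnot : c - ε ∉ S := fun h => by linarith [csInf_le hbdd h]
  obtain ⟨j, hj⟩ : ∃ j, (c - ε) * z j < z (j + 1) := by simpa [hS] using hnot
  have hpos : 0 < z j := pos_of_mul_pos_right (by linarith [hcS j] : 0 < ε * z j) hε.le
  have key : ∀ i : ℕ, (c ^ i - i * ε) * z j ≤ z (j + i) := by
    intro i
    induction i with
    | zero => simp
    | succ i ih =>
      have h1 := hg j i
      have h2 := mul_le_mul_of_nonneg_left ih hc0
      have h3 : c * (i * ε * z j) ≤ 1 * (i * ε * z j) := by gcongr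
      rw [← add_assoc]
      push_cast
      rw [pow_succ]
      linear_combination h1 + h2 + h3 + hj
  have h1 := key 1
  have hk := key k
  have : (c + c ^ k) * z j ≤ (1 + δ) * z j := by
    rw [← hεδ]
    push_cast at h1
    linear_combination h1 + hk + (hrec j).ge
  exact le_of_mul_le_mul_right this hpos

theorem root_le_of_recurrence {k : ℕ} {z : ℕ → ℝ} (h0 : z 0 = 1) (hz : ∀ j, 0 ≤ z j)
    (hrec : ∀ j, z j = z (j + 1) + z (j + k)) : ∃ c, 1 ≤ c + c ^ k ∧ 0 ≤ c ∧ c ≤ z 1 := by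
  have hanti : ∀ j, z (j + 1) ≤ z j := fun j => by linarith [hrec j, hz (j + k)]
  set S : Set ℝ := {c | ∀ j, c * z j ≤ z (j + 1)} with hS
  have hupp : ∀ c ∈ S, c ≤ z 1 := fun c hc => by simpa [h0] using hc 0
  have hbdd : BddAbove S := ⟨z 1, hupp⟩
  have h0S : (0 : ℝ) ∈ S := fun j => by simpa using hz _
  set c := sSup S
  have hzc : c ≤ z 1 := csSup_le ⟨0, h0S⟩ hupp
  have hc0 : 0 ≤ c := le_csSup hbdd h0S
  have hc1 : c ≤ 1 := by linarith [hanti 0]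
  have hcS : ∀ j, 0 ≤ z (j + 1) - c * z j := by
    intro j
    rw [sub_nonneg]
    rcases (hz j).eq_or_lt with h | h
    · rw [← h]
      simpa using hz _
    · rw [← le_div_iff₀ h]
      exact csSup_le ⟨0, h0S⟩ fun d hd => by
        rw [le_div_iff₀ h]
        exact hd j
  have hg : ∀ j i, z (j + i + 1) - c * z (j + i) ≤ z (j + 1) - c * z j := by
    intro j i
    induction i with
    | zero => exact le_rfl
    | succ i ih =>
      refine le_trans ?_ ih
      have h1 := hrec (j + i)
      have h2 := hrec (j + i + 1)
      have h3 := hcS (j + i + k)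
      rw [show j + i + 1 + k = j + i + k + 1 by ring] at h2
      rw [← add_assoc]
      linear_combination h3 + c * h1 - h2
  refine ⟨c, ?_, hc0, hzc⟩
  refine le_of_forall_pos_le_add fun δ hδ => ?_
  obtain ⟨ε, hε, hεδ⟩ : ∃ ε : ℝ, 0 < ε ∧ (k + 1) * ε = δ :=
    ⟨δ / (k + 1), by positivity, by field_simp⟩
  have hnot : c + ε ∉ S := fun h => by linarith [le_csSup hbdd h]
  obtain ⟨j, hj⟩ : ∃ j, z (j + 1) < (c + ε) * z j := by simpa [hS] using hnot
  have hpos : 0 < z j := pos_of_mul_pos_right (by linarith [hcS j] : 0 < ε * z j) hε.le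
  have key : ∀ i : ℕ, z (j + i) ≤ (c ^ i + i * ε) * z j := by
    intro i
    induction i with
    | zero => simp
    | succ i ih =>
      have h1 := hg j i
      have h2 := mul_le_mul_of_nonneg_left ih hc0
      have h3 : c * (i * ε * z j) ≤ 1 * (i * ε * z j) := by gcongr
      rw [← add_assoc]
      push_cast
      rw [pow_succ]
      linear_combination h1 + h2 + h3 + hj
  have h1 := key 1
  have hk := key k
  have : 1 * z j ≤ (c + c ^ k + δ) * z j := by
    rw [← hεδ]
    push_cast at h1
    linear_combination h1 + hk + (hrec j).le
  exact le_of_mul_le_mul_right this hpos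

/-- The powers of the root of `X ^ k + X - 1` give the only nonnegative solution of the
recurrence `z j = z (j + 1) + z (j + k)` normalised by `z 0 = 1`; here for the index `1`. -/
theorem eq_root_of_recurrence {k : ℕ} {z : ℕ → ℝ} (h0 : z 0 = 1) (hz : ∀ j, 0 ≤ z j)
    (hrec : ∀ j, z j = z (j + 1) + z (j + k)) {α : ℝ} (hα0 : 0 < α) (hα : α ^ k + α - 1 = 0) :
    z 1 = α := by
  obtain ⟨c, hc, hc0, hzc⟩ := le_root_of_recurrence h0 hz hrec
  obtain ⟨d, hd, hd0, hdz⟩ := root_le_of_recurrence h0 hz hrec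
  apply le_antisymm
  · refine hzc.trans (le_of_not_gt fun h => ?_)
    have := pow_le_pow_left₀ hα0.le h.le k
    linarith
  · refine le_trans (le_of_not_gt fun h => ?_) hdz
    have := pow_le_pow_left₀ hd0 h.le k
    linarith

theorem LkAdjoint_iterate_tendsto_atTop (k j : ℕ) : Tendsto (LkAdjoint k)^[j] atTop atTop :=
  tendsto_atTop_atTop.2 fun m => ⟨(Lk k)^[j] m, fun n hn => by
    have := ((gc_LkAdjoint k).iterate_nat j).monotone_l hn
    rwa [LkAdjoint_iterate_Lk_iterate] at this⟩

theorem abs_sub_LkAdjoint_sub_le {k : ℕ} (hk : 1 ≤ k) (m : ℕ) :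
    |(m : ℝ) - LkAdjoint k m - (LkAdjoint k)^[k] m| ≤ 1 := by
  have hle : ∀ n, (LkAdjoint k)^[k] n ≤ n := fun n =>
    (iterate_eq_of_eq_on_le (fun _ _ => rfl) (LkAdjoint_le k) k).2
  rcases m with _ | m
  · have h1 := hle 0
    have h2 := LkAdjoint_le k 0
    rw [Nat.le_zero] at h1 h2
    simp [h1, h2]
  · have h1 := LkAdjoint_succ hk m
    have h2 := hle m
    have h3 : (LkAdjoint k (m + 1) : ℝ) + (LkAdjoint k)^[k] m = (m + 1 : ℕ) := by
      exact_mod_cast (by omega : LkAdjoint k (m + 1) + (LkAdjoint k)^[k] m = m + 1)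
    have h4 : ((LkAdjoint k)^[k] (m + 1) : ℝ) ≤ (LkAdjoint k)^[k] m + 1 := by
      exact_mod_cast LkAdjoint_iterate_succ_le k k m
    have h5 : ((LkAdjoint k)^[k] m : ℝ) ≤ (LkAdjoint k)^[k] (m + 1) := by
      exact_mod_cast ((gc_LkAdjoint k).iterate_nat k).monotone_l (Nat.le_succ m)
    rw [abs_le]
    constructor <;> linarith

theorem tendsto_LkAdjoint_div {k : ℕ} (hk : 1 ≤ k) {α : ℝ} (hα0 : 0 < α)
    (hα : α ^ k + α - 1 = 0) :
    Tendsto (fun n : ℕ => (LkAdjoint k n : ℝ) / n) atTop (𝓝 α) := by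
  rw [tendsto_iff_ultrafilter]
  intro U hU
  have hlim : ∀ j : ℕ, ∃ z ∈ Set.Icc (0 : ℝ) 1,
      Tendsto (fun n : ℕ => ((LkAdjoint k)^[j] n : ℝ) / n) U (𝓝 z) := by
    intro j
    refine isCompact_Icc.ultrafilter_le_nhds
      (U.map fun n : ℕ => ((LkAdjoint k)^[j] n : ℝ) / n) ?_
    rw [le_principal_iff, Ultrafilter.coe_map, Filter.mem_map]
    have hmem : ∀ n : ℕ, ((LkAdjoint k)^[j] n : ℝ) / n ∈ Set.Icc (0 : ℝ) 1 := fun n => by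
      refine ⟨by positivity, div_le_one_of_le₀ ?_ (by positivity)⟩
      exact_mod_cast (iterate_eq_of_eq_on_le (fun _ _ => rfl) (LkAdjoint_le k) j).2
    exact Filter.univ_mem' hmem
  choose z hz hlim using hlim
  have h0 : z 0 = 1 := by
    refine tendsto_nhds_unique (hlim 0) (tendsto_const_nhds.congr' ?_)
    filter_upwards [hU (eventually_ge_atTop 1)] with n hn
    have : (n : ℝ) ≠ 0 := by positivity
    simp [this]
  have hrec : ∀ j, z j = z (j + 1) + z (j + k) := by
    intro j
    have h1 := ((hlim j).sub (hlim (j + 1))).sub (hlim (j + k))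
    have h2 : Tendsto (fun n : ℕ => ((LkAdjoint k)^[j] n : ℝ) / n -
        ((LkAdjoint k)^[j + 1] n : ℝ) / n - ((LkAdjoint k)^[j + k] n : ℝ) / n) U (𝓝 0) := by
      refine squeeze_zero_norm (fun n => ?_) (tendsto_one_div_atTop_nhds_zero_nat.mono_left hU)
      rw [← sub_div, ← sub_div, norm_div, Real.norm_eq_abs, Real.norm_natCast]
      gcongr
      have := abs_sub_LkAdjoint_sub_le hk ((LkAdjoint k)^[j] n)
      rwa [← Function.iterate_succ_apply' (LkAdjoint k), ← Function.iterate_add_apply,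
        add_comm k j] at this
    linarith [tendsto_nhds_unique h1 h2]
  rw [← eq_root_of_recurrence h0 (fun j => (hz j).1) hrec hα0 hα]
  exact hlim 1

theorem tendsto_LkAdjoint_iterate_div {k : ℕ} {α : ℝ}
    (h : Tendsto (fun n : ℕ => (LkAdjoint k n : ℝ) / n) atTop (𝓝 α)) (j : ℕ) :
    Tendsto (fun n : ℕ => ((LkAdjoint k)^[j] n : ℝ) / n) atTop (𝓝 (α ^ j)) := by
  induction j with
  | zero =>
    rw [pow_zero]
    refine tendsto_const_nhds.congr' ?_
    filter_upwards [eventually_ge_atTop 1] with n hn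
    have : (n : ℝ) ≠ 0 := by positivity
    simp [this]
  | succ j ih =>
    rw [pow_succ']
    refine ((h.comp (LkAdjoint_iterate_tendsto_atTop k j)).mul ih).congr fun n => ?_
    rw [Function.iterate_succ_apply', Function.comp_apply]
    rcases Nat.eq_zero_or_pos ((LkAdjoint k)^[j] n) with h0 | h0
    · have := LkAdjoint_le k 0
      simp_all
    · have : ((LkAdjoint k)^[j] n : ℝ) ≠ 0 := by positivity
      field_simp

theorem tendsto_Lk_iterate_div {k : ℕ} {α : ℝ} (hα0 : 0 < α)
    (h : Tendsto (fun n : ℕ => (LkAdjoint k n : ℝ) / n) atTop (𝓝 α)) (j : ℕ) :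
    Tendsto (fun n : ℕ => ((Lk k)^[j] n : ℝ) / n) atTop (𝓝 (α⁻¹ ^ j)) := by
  rw [inv_pow]
  refine (((tendsto_LkAdjoint_iterate_div h j).comp
    ((Lk_strictMono k).iterate j).tendsto_atTop).inv₀ (by positivity)).congr fun n => ?_
  simp [LkAdjoint_iterate_Lk_iterate]

theorem tendsto_Ceq_self_div {k : ℕ} {α : ℝ} (hα0 : 0 < α)
    (h : Tendsto (fun n : ℕ => (LkAdjoint k n : ℝ) / n) atTop (𝓝 α)) :
    Tendsto (fun n : ℕ => (Ceq k k n : ℝ) / n) atTop (𝓝 (α⁻¹ - 1)) := by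
  have h1 := (tendsto_Lk_iterate_div hα0 h 1).sub_const 1
  rw [pow_one] at h1
  refine h1.congr' ?_
  filter_upwards [eventually_ge_atTop 1] with n hn
  have : (n : ℝ) ≠ 0 := by positivity
  rw [Function.iterate_one, Lk_eq]
  push_cast
  field_simp
  ring

/-- If the letter `i'` occurs in the image of a prefix as often as `i` does in the prefix, then
its frequency is `α` times the frequency of `i`. -/
theorem tendsto_Ceq_div_of_Ceq_Lk {k i i' : ℕ} {α γ : ℝ} (hC : ∀ n, Ceq k i' (Lk k n) = Ceq k i n)
    (h : Tendsto (fun n : ℕ => (LkAdjoint k n : ℝ) / n) atTop (𝓝 α))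
    (hi : Tendsto (fun n : ℕ => (Ceq k i n : ℝ) / n) atTop (𝓝 γ)) :
    Tendsto (fun n : ℕ => (Ceq k i' n : ℝ) / n) atTop (𝓝 (α * γ)) := by
  have h1 := h.mul (hi.comp (LkAdjoint_iterate_tendsto_atTop k 1))
  have hL : ∀ n, Lk k (LkAdjoint k n) ≤ n + 1 := by
    intro n
    rcases Nat.eq_zero_or_pos (LkAdjoint k n) with h0 | h0
    · rw [h0, Lk_zero]; omega
    · have h2 : ¬ n ≤ Lk k (LkAdjoint k n - 1) := fun h => by
        have := (gc_LkAdjoint k).l_le h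
        omega
      have h3 := Lk_succ_le k (LkAdjoint k n - 1)
      rw [Nat.sub_add_cancel h0] at h3
      omega
  have h2 : Tendsto (fun n : ℕ => (Ceq k i' n : ℝ) / n -
      (LkAdjoint k n : ℝ) / n * ((Ceq k i (LkAdjoint k n) : ℝ) / LkAdjoint k n)) atTop (𝓝 0) := by
    refine squeeze_zero_norm (fun n => ?_) tendsto_one_div_atTop_nhds_zero_nat
    have h3 : (LkAdjoint k n : ℝ) / n * ((Ceq k i (LkAdjoint k n) : ℝ) / LkAdjoint k n) =
        (Ceq k i (LkAdjoint k n) : ℝ) / n := by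
      rcases Nat.eq_zero_or_pos (LkAdjoint k n) with h0 | h0
      · simp [h0, Ceq]
      · have : (LkAdjoint k n : ℝ) ≠ 0 := by positivity
        field_simp
    rw [h3, ← sub_div, norm_div, Real.norm_eq_abs, Real.norm_natCast]
    gcongr
    rw [← hC, abs_le]
    have h4 : (Ceq k i' n : ℝ) ≤ Ceq k i' (Lk k (LkAdjoint k n)) := by
      exact_mod_cast Ceq_mono k i' ((gc_LkAdjoint k).le_u_l n)
    have h5 : (Ceq k i' (Lk k (LkAdjoint k n)) : ℝ) ≤ Ceq k i' n + 1 := by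
      exact_mod_cast (Ceq_mono k i' (hL n)).trans (Ceq_succ_le k i' n)
    constructor <;> linarith
  have h3 := h2.add h1
  rw [zero_add] at h3
  exact h3.congr fun n => by simp

theorem inv_eq_of_root {k : ℕ} (hk : 1 ≤ k) {α β : ℝ} (hα0 : 0 < α) (hα : α ^ k + α - 1 = 0)
    (hβ0 : 0 < β) (hβ : β ^ k - β ^ (k - 1) - 1 = 0) : α⁻¹ = β := by
  obtain ⟨k, rfl⟩ : ∃ i, k = i + 1 := ⟨k - 1, by omega⟩
  rw [Nat.add_sub_cancel] at hβ
  have h : β⁻¹ ^ (k + 1) + β⁻¹ = 1 := by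
    rw [inv_pow]
    field_simp
    rw [pow_succ] at hβ ⊢
    linear_combination -β * hβ
  suffices hαβ : α = β⁻¹ by rw [hαβ, inv_inv]
  rcases lt_trichotomy α β⁻¹ with h1 | h1 | h1
  · have := pow_le_pow_left₀ hα0.le h1.le (k + 1)
    linarith
  · exact h1
  · have := pow_le_pow_left₀ (inv_pos.2 hβ0).le h1.le (k + 1)
    linarith

/-- Limits: F_k^j(n)/n → α_k^j, L_k^j(n)/n → β_k^j, C_k^{(=i)}(n)/n → α_k^{k+i-1} for
1 ≤ i < k, and C_k^{(=k)}(n)/n → α_k^{k-1} = β_k - 1. -/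
theorem stmt10 (k j : ℕ) (hk : 1 ≤ k) (F : ℕ → ℕ)
    (hF0 : F 0 = 0) (hF : ∀ n, 1 ≤ n → F n = n - F^[k] (n - 1))
    (α β : ℝ) (hα : 0 < α ∧ α ^ k + α - 1 = 0) (hβ : 0 < β ∧ β ^ k - β ^ (k - 1) - 1 = 0) :
    Filter.Tendsto (fun n : ℕ => (F^[j] n : ℝ) / n) Filter.atTop (nhds (α ^ j)) ∧
    Filter.Tendsto (fun n : ℕ => ((Lk k)^[j] n : ℝ) / n) Filter.atTop (nhds (β ^ j)) ∧
    (∀ i, 1 ≤ i → i < k →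
      Filter.Tendsto (fun n : ℕ => (Ceq k i n : ℝ) / n) Filter.atTop (nhds (α ^ (k + i - 1)))) ∧
    Filter.Tendsto (fun n : ℕ => (Ceq k k n : ℝ) / n) Filter.atTop (nhds (α ^ (k - 1))) ∧
    α ^ (k - 1) = β - 1 := by
  rw [eq_LkAdjoint hk hF0 hF]
  obtain ⟨hα0, hα⟩ := hα
  have hG := tendsto_LkAdjoint_div hk hα0 hα
  have hαβ := inv_eq_of_root hk hα0 hα hβ.1 hβ.2
  have hpow : α ^ (k - 1) = β - 1 := by
    rw [← hαβ]
    obtain ⟨k, rfl⟩ : ∃ i, k = i + 1 := ⟨k - 1, by omega⟩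
    rw [Nat.add_sub_cancel]
    field_simp
    rw [pow_succ] at hα
    linear_combination hα
  have hCk : Tendsto (fun n : ℕ => (Ceq k k n : ℝ) / n) atTop (𝓝 (α ^ (k - 1))) := by
    rw [hpow, ← hαβ]
    exact tendsto_Ceq_self_div hα0 hG
  refine ⟨tendsto_LkAdjoint_iterate_div hG j, hαβ ▸ tendsto_Lk_iterate_div hα0 hG j, ?_, hCk, hpow⟩
  intro i hi
  induction i, hi using Nat.le_induction with
  | base =>
    intro hik
    have := tendsto_Ceq_div_of_Ceq_Lk (Ceq_one_Lk hik) hG hCk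
    rwa [← pow_succ', show k - 1 + 1 = k + 1 - 1 by omega] at this
  | succ i hi ih =>
    intro hik
    have := tendsto_Ceq_div_of_Ceq_Lk (Ceq_succ_Lk hi hik) hG (ih (by omega))
    rwa [← pow_succ', show k + i - 1 + 1 = k + (i + 1) - 1 by omega] at this
end

section
/- For k ≥ 1: (1) there exists N such that F_k(n) < F_{k+1}(n) for all n ≥ N; (2) there exists N such that F_k^k(n) > F_{k+1}^{k+1}(n) for all n ≥ N; (3) there exists N such that F_k^{k+1}(n) > F_{k+1}^{k+2}(n) for all n ≥ N. More generally, for a given j ≥ 0: if α_k ≥ j/(j+1) (which holds in particular when k ≥ j²), then F_k^{k+j}(n) > F_{k+1}^{k+j+1}(n) for all sufficiently large n; and if α_{k+1} ≤ j/(j+1) (which holds in particular when 1 ≤ k < j), then F_k^{k+j}(n) < F_{k+1}^{k+j+1}(n) for all sufficiently large n. -/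
open Filter Topology

/-- A positive sequence satisfying `ℓ i + ℓ i * ⋯ * ℓ (i + k - 1) = 1` that attains its maximum
at `0` is constant. -/
lemma eq_of_add_prod_eq_one_of_le {k : ℕ} {ℓ : ℕ → ℝ} (hpos : ∀ i, 0 < ℓ i)
    (h : ∀ i, ℓ i + ∏ j ∈ Finset.range k, ℓ (i + j) = 1) (hle : ∀ i, ℓ i ≤ ℓ 0) (i : ℕ) :
    ℓ i = ℓ 0 := by
  induction i with
  | zero => rfl
  | succ i ih =>
    have hshift : ℓ i * ∏ j ∈ Finset.range k, ℓ (i + 1 + j)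
        = (∏ j ∈ Finset.range k, ℓ (i + j)) * ℓ (i + k) := by
      rw [← Finset.prod_range_succ (fun j ↦ ℓ (i + j)), Finset.prod_range_succ']
      simp [mul_comm, add_assoc, add_comm 1]
    have hP : 0 < ∏ j ∈ Finset.range k, ℓ (i + j) := Finset.prod_pos fun j _ ↦ hpos _
    refine (hle _).antisymm ?_
    by_contra! hlt
    nlinarith [h i, h (i + 1), mul_pos (hpos i) (sub_pos.2 hlt),
      mul_nonneg hP.le (sub_nonneg.2 (hle (i + k)))]

/-- A positive sequence satisfying `ℓ i + ℓ i * ⋯ * ℓ (i + k - 1) = 1` that attains its minimum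
at `0` is constant. -/
lemma eq_of_add_prod_eq_one_of_ge {k : ℕ} {ℓ : ℕ → ℝ} (hpos : ∀ i, 0 < ℓ i)
    (h : ∀ i, ℓ i + ∏ j ∈ Finset.range k, ℓ (i + j) = 1) (hle : ∀ i, ℓ 0 ≤ ℓ i) (i : ℕ) :
    ℓ i = ℓ 0 := by
  induction i with
  | zero => rfl
  | succ i ih =>
    have hshift : ℓ i * ∏ j ∈ Finset.range k, ℓ (i + 1 + j)
        = (∏ j ∈ Finset.range k, ℓ (i + j)) * ℓ (i + k) := by
      rw [← Finset.prod_range_succ (fun j ↦ ℓ (i + j)), Finset.prod_range_succ']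
      simp [mul_comm, add_assoc, add_comm 1]
    have hP : 0 < ∏ j ∈ Finset.range k, ℓ (i + j) := Finset.prod_pos fun j _ ↦ hpos _
    refine le_antisymm ?_ (hle _)
    by_contra! hlt
    nlinarith [h i, h (i + 1), mul_pos (hpos i) (sub_pos.2 hlt),
      mul_nonneg hP.le (sub_nonneg.2 (hle (i + k)))]

lemma tendsto_iterate_div {g : ℕ → ℕ} (hg : Tendsto g atTop atTop) {l : Filter ℕ}
    (hl : l ≤ atTop) {ℓ : ℕ → ℝ}
    (h : ∀ j, Tendsto (fun n ↦ (g n : ℝ) / n) (map g^[j] l) (𝓝 (ℓ j))) (i : ℕ) :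
    Tendsto (fun n ↦ (g^[i] n : ℝ) / n) l (𝓝 (∏ j ∈ Finset.range i, ℓ j)) := by
  induction i with
  | zero =>
    refine Tendsto.congr' ?_ (tendsto_const_nhds (x := (1 : ℝ)))
    filter_upwards [hl (eventually_gt_atTop 0)] with n hn
    have : (n : ℝ) ≠ 0 := by positivity
    simp [this]
  | succ i ih =>
    rw [Finset.prod_range_succ]
    refine (ih.mul (tendsto_map'_iff.1 (h i))).congr' ?_
    filter_upwards [hl ((hg.iterate i).eventually_gt_atTop 0)] with n hn
    have : (g^[i] n : ℝ) ≠ 0 := by positivity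
    simp only [Function.comp, Function.iterate_succ_apply']
    field_simp

lemma eq_of_pow_add_self_eq {k : ℕ} {x y : ℝ} (hx : 0 < x) (hy : 0 < y)
    (h : x ^ k + x = y ^ k + y) : x = y := by
  rcases lt_trichotomy x y with hlt | rfl | hlt
  · linarith [pow_le_pow_left₀ hx.le hlt.le k]
  · rfl
  · linarith [pow_le_pow_left₀ hy.le hlt.le k]

/-- If `g` satisfies `g n + g^[k] n = n + O(1)` then `g n / n` tends to the positive root
of `X ^ k + X - 1`. -/
lemma tendsto_div_of_iterate_bounds {k : ℕ} {g : ℕ → ℕ} {a : ℝ} (hle : ∀ n, g n ≤ n)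
    (hhalf : ∀ n, n ≤ 2 * g n) (hlow : ∀ n, n ≤ g n + g^[k] n)
    (hupp : ∀ n, g n + g^[k] n ≤ n + 1) (ha : 0 < a) (hroot : a ^ k + a - 1 = 0) :
    Tendsto (fun n ↦ (g n : ℝ) / n) atTop (𝓝 a) := by
  have hg : Tendsto g atTop atTop :=
    tendsto_atTop_mono (fun n ↦ show n / 2 ≤ g n by have := hhalf n; omega)
      (Nat.tendsto_div_const_atTop two_ne_zero)
  set f : ℕ → ℝ := fun n ↦ (g n : ℝ) / n with hf
  have hf_mem : ∀ᶠ n in atTop, f n ∈ Set.Icc (1 / 2 : ℝ) 1 := by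
    filter_upwards [eventually_gt_atTop 0] with n hn
    have hn' : (0 : ℝ) < n := by positivity
    have h1 : (n : ℝ) ≤ 2 * g n := mod_cast hhalf n
    have h2 : (g n : ℝ) ≤ n := mod_cast hle n
    exact ⟨by rw [hf, le_div_iff₀ hn']; linarith, by rw [hf, div_le_one hn']; exact h2⟩
  have hlim (U : Ultrafilter ℕ) (hU : (U : Filter ℕ) ≤ atTop) :
      ∃ x ∈ Set.Icc (1 / 2 : ℝ) 1, Tendsto f U (𝓝 x) :=
    isCompact_Icc.ultrafilter_le_nhds' (U.map f) (hU hf_mem)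
  set C : Set ℝ := {x | MapClusterPt x atTop f} with hC
  have hC_sub : C ⊆ Set.Icc (1 / 2 : ℝ) 1 := fun x hx ↦ by
    obtain ⟨U, hU, hUx⟩ := mapClusterPt_iff_ultrafilter.1 hx
    exact isClosed_Icc.mem_of_tendsto hUx (hU hf_mem)
  have hC_mem {U : Ultrafilter ℕ} (hU : (U : Filter ℕ) ≤ atTop) {x : ℝ}
      (hx : Tendsto f U (𝓝 x)) : x ∈ C := mapClusterPt_iff_ultrafilter.2 ⟨U, hU, hx⟩
  have hC_compact : IsCompact C :=
    isCompact_Icc.of_isClosed_subset isClosed_setOfPred_clusterPt hC_sub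
  have hC_nonempty : C.Nonempty := by
    obtain ⟨x, -, hx⟩ := hlim (Ultrafilter.of atTop) (Ultrafilter.of_le atTop)
    exact ⟨x, hC_mem (Ultrafilter.of_le atTop) hx⟩
  have hseq {x : ℝ} (hx : x ∈ C) : ∃ ℓ : ℕ → ℝ, ℓ 0 = x ∧ (∀ i, ℓ i ∈ C) ∧
      ∀ i, ℓ i + ∏ j ∈ Finset.range k, ℓ (i + j) = 1 := by
    obtain ⟨U, hU, hUx⟩ := mapClusterPt_iff_ultrafilter.1 hx
    have hUi (i : ℕ) : (U.map g^[i] : Filter ℕ) ≤ atTop :=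
      (map_mono hU).trans (hg.iterate i)
    choose ℓ _ hℓ using fun i ↦ hlim (U.map g^[i]) (hUi i)
    refine ⟨ℓ, tendsto_nhds_unique (hℓ 0) (by simpa using hUx),
      fun i ↦ hC_mem (hUi i) (hℓ i), fun i ↦ ?_⟩
    have hprod := tendsto_iterate_div hg (hUi i) (ℓ := fun j ↦ ℓ (i + j)) (fun j ↦ by
      have := hℓ (i + j)
      rwa [Ultrafilter.coe_map, add_comm, Function.iterate_add, ← map_map, add_comm] at this) k
    refine tendsto_nhds_unique ((hℓ i).add hprod) ?_
    refine Tendsto.mono_left ?_ (hUi i)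
    have hinv : Tendsto (fun n : ℕ ↦ 1 + (n : ℝ)⁻¹) atTop (𝓝 1) := by
      simpa using tendsto_inv_atTop_nhds_zero_nat (𝕜 := ℝ) |>.const_add 1
    refine tendsto_of_tendsto_of_tendsto_of_le_of_le' tendsto_const_nhds hinv ?_ ?_
    all_goals
      filter_upwards [eventually_gt_atTop 0] with n hn
      have hn' : (0 : ℝ) < n := by positivity
      have h1 : (n : ℝ) ≤ g n + g^[k] n := mod_cast hlow n
      have h2 : (g n : ℝ) + g^[k] n ≤ n + 1 := mod_cast hupp n
      simp only [hf]
      rw [← add_div]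
    · rwa [le_div_iff₀ hn', one_mul]
    · rw [div_le_iff₀ hn', add_mul, inv_mul_cancel₀ hn'.ne', one_mul]
      exact h2
  have hC_pos {x : ℝ} (hx : x ∈ C) : 0 < x := by linarith [(hC_sub hx).1]
  have hconst {ℓ : ℕ → ℝ} (h : ∀ i, ℓ i + ∏ j ∈ Finset.range k, ℓ (i + j) = 1)
      (h0 : 0 < ℓ 0) (hc : ∀ i, ℓ i = ℓ 0) : ℓ 0 = a := by
    refine eq_of_pow_add_self_eq (k := k) h0 ha ?_
    have := h 0
    simp only [hc, Finset.prod_const, Finset.card_range] at this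
    linarith
  have hC_le {x : ℝ} (hx : x ∈ C) : x ≤ a := by
    obtain ⟨b, hb, hmax⟩ := hC_compact.exists_isGreatest hC_nonempty
    obtain ⟨ℓ, rfl, hℓ, h⟩ := hseq hb
    rw [← hconst h (hC_pos hb) (eq_of_add_prod_eq_one_of_le (fun i ↦ hC_pos (hℓ i)) h
      fun i ↦ hmax (hℓ i))]
    exact hmax hx
  have hC_ge {x : ℝ} (hx : x ∈ C) : a ≤ x := by
    obtain ⟨b, hb, hmin⟩ := hC_compact.exists_isLeast hC_nonempty
    obtain ⟨ℓ, rfl, hℓ, h⟩ := hseq hb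
    rw [← hconst h (hC_pos hb) (eq_of_add_prod_eq_one_of_ge (fun i ↦ hC_pos (hℓ i)) h
      fun i ↦ hmin (hℓ i))]
    exact hmin hx
  refine tendsto_iff_ultrafilter _ _ _ |>.2 fun U hU ↦ ?_
  obtain ⟨x, -, hx⟩ := hlim U hU
  have hxC := hC_mem hU hx
  rwa [← (hC_le hxC).antisymm (hC_ge hxC)]

lemma iterate_le_self {g : ℕ → ℕ} (hle : ∀ n, g n ≤ n) (j n : ℕ) : g^[j] n ≤ n :=
  Function.iterate_le_id_of_le_id hle j n

lemma iterate_succ_eq_or {g : ℕ → ℕ} (hle : ∀ n, g n ≤ n) {n : ℕ}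
    (h : ∀ m ≤ n, g (m + 1) = g m ∨ g (m + 1) = g m + 1) (j : ℕ) :
    g^[j] (n + 1) = g^[j] n ∨ g^[j] (n + 1) = g^[j] n + 1 := by
  induction j with
  | zero => simp
  | succ j ih =>
    simp only [Function.iterate_succ_apply']
    rcases ih with ih | ih <;> rw [ih]
    · exact Or.inl rfl
    · exact h _ (iterate_le_self hle j n)

section Hofstadter

variable {k : ℕ} {g : ℕ → ℕ}

lemma hofstadter_le (h0 : g 0 = 0) (hrec : ∀ n, 1 ≤ n → g n = n - g^[k] (n - 1)) (n : ℕ) :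
    g n ≤ n := by
  rcases Nat.eq_zero_or_pos n with rfl | hn
  · exact h0.le
  · rw [hrec n hn]
    exact Nat.sub_le _ _

lemma hofstadter_succ_eq_or (h0 : g 0 = 0) (hrec : ∀ n, 1 ≤ n → g n = n - g^[k] (n - 1))
    (n : ℕ) : g (n + 1) = g n ∨ g (n + 1) = g n + 1 := by
  have hle := hofstadter_le h0 hrec
  induction n using Nat.strong_induction_on with
  | _ n ih =>
    rcases n with _ | n
    · have := hle 1
      simp only [h0, zero_add]
      omega
    · have h1 := hrec (n + 1) (by omega)
      have h2 := hrec (n + 1 + 1) (by omega)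
      simp only [Nat.add_sub_cancel] at h1 h2
      have h3 := iterate_le_self hle k n
      rcases iterate_succ_eq_or hle (n := n) (fun m hm ↦ ih m (by omega)) k with h | h <;> omega

lemma hofstadter_add_iterate (h0 : g 0 = 0) (hrec : ∀ n, 1 ≤ n → g n = n - g^[k] (n - 1))
    (n : ℕ) : n ≤ g n + g^[k] n ∧ g n + g^[k] n ≤ n + 1 := by
  have hle := hofstadter_le h0 hrec
  rcases n with _ | n
  · simp [h0, Function.iterate_fixed h0]
  · have h1 := hrec (n + 1) (by omega)
    simp only [Nat.add_sub_cancel] at h1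
    have h3 := iterate_le_self hle k n
    rcases iterate_succ_eq_or hle (fun m (_ : m ≤ n) ↦ hofstadter_succ_eq_or h0 hrec m) k
      with h | h <;> omega

lemma tendsto_hofstadter_iterate_div (hk : 1 ≤ k) (h0 : g 0 = 0)
    (hrec : ∀ n, 1 ≤ n → g n = n - g^[k] (n - 1)) {a : ℝ} (ha : 0 < a)
    (hroot : a ^ k + a - 1 = 0) (i : ℕ) :
    Tendsto (fun n ↦ (g^[i] n : ℝ) / n) atTop (𝓝 (a ^ i)) := by
  have hle := hofstadter_le h0 hrec
  have hsum := hofstadter_add_iterate h0 hrec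
  have hhalf (n : ℕ) : n ≤ 2 * g n := by
    obtain ⟨m, rfl⟩ := Nat.exists_eq_add_of_le' hk
    have h1 := (hsum n).1
    have h2 := iterate_le_self hle m (g n)
    rw [Function.iterate_succ_apply] at h1
    omega
  have hlim := tendsto_div_of_iterate_bounds hle hhalf (fun n ↦ (hsum n).1)
    (fun n ↦ (hsum n).2) ha hroot
  have hg : Tendsto g atTop atTop :=
    tendsto_atTop_mono (fun n ↦ show n / 2 ≤ g n by have := hhalf n; omega)
      (Nat.tendsto_div_const_atTop two_ne_zero)
  simpa using tendsto_iterate_div hg le_rfl (ℓ := fun _ ↦ a)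
    (fun j ↦ hlim.mono_left (hg.iterate j)) i

end Hofstadter

lemma exists_forall_lt_of_tendsto_div {u v : ℕ → ℕ} {a b : ℝ}
    (hu : Tendsto (fun n ↦ (u n : ℝ) / n) atTop (𝓝 a))
    (hv : Tendsto (fun n ↦ (v n : ℝ) / n) atTop (𝓝 b)) (hab : a < b) :
    ∃ N, ∀ n, N ≤ n → u n < v n := by
  refine eventually_atTop.1 ?_
  filter_upwards [hu.eventually_lt hv hab, eventually_gt_atTop 0] with n h hn
  have hn' : (0 : ℝ) < n := by positivity
  exact_mod_cast (div_lt_div_iff_of_pos_right hn').1 h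

lemma pow_mul_one_sub_lt_of_le_left {j : ℕ} {x y : ℝ} (hj : (j : ℝ) / (j + 1) ≤ x)
    (hxy : x < y) (hy : y < 1) : y ^ j * (1 - y) < x ^ j * (1 - x) := by
  have hx0 : 0 ≤ x := le_trans (by positivity) hj
  have hy0 : 0 < y := hx0.trans_lt hxy
  rw [div_le_iff₀ (by positivity)] at hj
  have hber := one_add_mul_le_pow (a := x / y - 1) (by linarith [div_nonneg hx0 hy0.le]) j
  rw [add_sub_cancel, div_pow, le_div_iff₀ (by positivity)] at hber
  have hlt : 1 - y < (1 + j * (x / y - 1)) * (1 - x) := by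
    have : (1 + j * (x / y - 1)) * (1 - x) - (1 - y) = (y - x) * (y - j * (1 - x)) / y := by
      field_simp
      ring
    have : 0 < (y - x) * (y - j * (1 - x)) / y :=
      div_pos (mul_pos (by linarith) (by linarith)) hy0
    linarith
  nlinarith [mul_lt_mul_of_pos_left hlt (pow_pos hy0 j),
    mul_le_mul_of_nonneg_right hber (show 0 ≤ 1 - x by linarith)]

lemma pow_mul_one_sub_lt_of_le_right {j : ℕ} {x y : ℝ} (hx : 0 < x) (hxy : x < y)
    (hj : y ≤ (j : ℝ) / (j + 1)) (hy : y < 1) : x ^ j * (1 - x) < y ^ j * (1 - y) := by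
  have hy0 : 0 < y := hx.trans hxy
  rw [le_div_iff₀ (by positivity)] at hj
  have hber := one_add_mul_le_pow (a := y / x - 1) (by linarith [div_pos hy0 hx]) j
  rw [add_sub_cancel, div_pow, le_div_iff₀ (by positivity)] at hber
  have hlt : 1 - x < (1 + j * (y / x - 1)) * (1 - y) := by
    have : (1 + j * (y / x - 1)) * (1 - y) - (1 - x) = (y - x) * (j * (1 - y) - x) / x := by
      field_simp
      ring
    have : 0 < (y - x) * (j * (1 - y) - x) / x :=
      div_pos (mul_pos (by linarith) (by linarith)) hx
    linarith
  nlinarith [mul_lt_mul_of_pos_left hlt (pow_pos hx j),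
    mul_le_mul_of_nonneg_right hber (show 0 ≤ 1 - y by linarith)]

lemma root_lt_root_succ {k : ℕ} {x y : ℝ} (hx : 0 < x) (hxk : x ^ k + x - 1 = 0) (hy : 0 < y)
    (hyk : y ^ (k + 1) + y - 1 = 0) : x < y := by
  by_contra! hyx
  have h1 := pow_le_pow_left₀ hy.le hyx (k + 1)
  have h2 : x ^ (k + 1) < x ^ k :=
    pow_lt_pow_right_of_lt_one₀ hx (by linarith [pow_pos hx k]) k.lt_succ_self
  linarith

lemma div_succ_le_root {j k : ℕ} (hjk : j ^ 2 ≤ k) {x : ℝ} (hx : 0 < x)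
    (hxk : x ^ k + x - 1 = 0) : (j : ℝ) / (j + 1) ≤ x := by
  rcases Nat.eq_zero_or_pos j with rfl | hj
  · simpa using hx.le
  have hj' : (0 : ℝ) < j := by positivity
  by_contra! hlt
  have hber := one_add_mul_le_pow (a := (1 / j : ℝ)) (by linarith [one_div_pos.2 hj']) k
  have hjk' : (j : ℝ) ^ 2 ≤ k := mod_cast hjk
  have h1 : (j : ℝ) + 1 ≤ (1 + 1 / j) ^ k := by
    refine le_trans ?_ hber
    have : (j : ℝ) ≤ k * (1 / j) := by
      rw [mul_one_div, le_div_iff₀ hj']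
      nlinarith
    linarith
  have h2 : ((j : ℝ) / (j + 1)) ^ k ≤ 1 / (j + 1) := by
    have : (j : ℝ) / (j + 1) = (1 + 1 / (j : ℝ))⁻¹ := by field_simp
    rw [this, inv_pow, ← one_div]
    exact one_div_le_one_div_of_le (by positivity) h1
  have h3 := pow_le_pow_left₀ hx.le hlt.le k
  have h4 : (j : ℝ) / (j + 1) + 1 / (j + 1) = 1 := by field_simp
  linarith

lemma root_le_div_succ {j k : ℕ} (hkj : k ≤ j) {x : ℝ} (hxk : x ^ k + x - 1 = 0) :
    x ≤ (j : ℝ) / (j + 1) := by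
  by_contra! hlt
  have hinv : (1 : ℝ) / (j + 1) ≤ 1 := by
    rw [div_le_one (by positivity)]
    linarith [Nat.cast_nonneg (α := ℝ) j]
  have hber := one_add_mul_le_pow (a := -(1 / (j + 1) : ℝ)) (by linarith) k
  have h4 : (j : ℝ) / (j + 1) = 1 + -(1 / (j + 1)) := by field_simp; ring
  have hkj' : (k : ℝ) ≤ j := mod_cast hkj
  have h3 := pow_le_pow_left₀ (show (0 : ℝ) ≤ j / (j + 1) by positivity) hlt.le k
  have h5 : (k : ℝ) * (1 / (j + 1)) ≤ j / (j + 1) := by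
    rw [mul_one_div]
    gcongr
  rw [← h4] at hber
  linarith

/-- Eventual strict comparisons between iterates of the Hofstadter functions F_k and F_{k+1}. -/
theorem stmt11 (k : ℕ) (hk : 1 ≤ k) (F : ℕ → ℕ → ℕ)
    (hF : ∀ k, 1 ≤ k → F k 0 = 0 ∧ ∀ n, 1 ≤ n → F k n = n - (F k)^[k] (n - 1))
    (α : ℕ → ℝ) (hα : ∀ k, 1 ≤ k → 0 < α k ∧ (α k) ^ k + α k - 1 = 0) :
    (∃ N, ∀ n, N ≤ n → F k n < F (k + 1) n) ∧
    (∃ N, ∀ n, N ≤ n → (F (k + 1))^[k + 1] n < (F k)^[k] n) ∧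
    (∃ N, ∀ n, N ≤ n → (F (k + 1))^[k + 2] n < (F k)^[k + 1] n) ∧
    (∀ j : ℕ,
      ((j : ℝ) / (j + 1) ≤ α k →
        ∃ N, ∀ n, N ≤ n → (F (k + 1))^[k + j + 1] n < (F k)^[k + j] n) ∧
      (j ^ 2 ≤ k → (j : ℝ) / (j + 1) ≤ α k) ∧
      (α (k + 1) ≤ (j : ℝ) / (j + 1) →
        ∃ N, ∀ n, N ≤ n → (F k)^[k + j] n < (F (k + 1))^[k + j + 1] n) ∧
      (k < j → α (k + 1) ≤ (j : ℝ) / (j + 1))) := by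
  have hk' : 1 ≤ k + 1 := by omega
  obtain ⟨hx, hxk⟩ := hα k hk
  obtain ⟨hy, hyk⟩ := hα (k + 1) hk'
  have hxy := root_lt_root_succ hx hxk hy hyk
  have hy1 : α (k + 1) < 1 := by linarith [pow_pos hy (k + 1)]
  have hlimx := tendsto_hofstadter_iterate_div hk (hF k hk).1 (hF k hk).2 hx hxk
  have hlimy := tendsto_hofstadter_iterate_div hk' (hF (k + 1) hk').1 (hF (k + 1) hk').2 hy hyk
  have hpowx (j : ℕ) : α k ^ (k + j) = α k ^ j * (1 - α k) := by
    rw [pow_add, show α k ^ k = 1 - α k by linarith, mul_comm]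
  have hpowy (j : ℕ) : α (k + 1) ^ (k + j + 1) = α (k + 1) ^ j * (1 - α (k + 1)) := by
    rw [add_right_comm, pow_add, show α (k + 1) ^ (k + 1) = 1 - α (k + 1) by linarith, mul_comm]
  have hgt (j : ℕ) (hj : (j : ℝ) / (j + 1) ≤ α k) :
      ∃ N, ∀ n, N ≤ n → (F (k + 1))^[k + j + 1] n < (F k)^[k + j] n := by
    refine exists_forall_lt_of_tendsto_div (hlimy _) (hlimx _) ?_
    rw [hpowx, hpowy]
    exact pow_mul_one_sub_lt_of_le_left hj hxy hy1
  refine ⟨?_, hgt 0 (div_succ_le_root (by simp) hx hxk),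
    hgt 1 (div_succ_le_root (by simpa using hk) hx hxk), fun j ↦ ⟨hgt j,
    fun hj ↦ div_succ_le_root hj hx hxk, fun hj ↦ ?_, fun hj ↦ root_le_div_succ hj hyk⟩⟩
  · exact exists_forall_lt_of_tendsto_div (hlimx 1) (hlimy 1) (by simpa using hxy)
  · refine exists_forall_lt_of_tendsto_div (hlimx _) (hlimy _) ?_
    rw [hpowx, hpowy]
    exact pow_mul_one_sub_lt_of_le_right hx hxy hj hy1
end

section
/- For all j ≥ 0, k ≥ 1 and n ≥ 0, we have F_k^j(n) ≤ F_{k+1}^j(n); in particular F_k(n) ≤ F_{k+1}(n) for all n ≥ 0. -/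
/-- `f` is the Hofstadter function with `k + 1` nested recursive calls. -/
def IsHofstadter (k : ℕ) (f : ℕ → ℕ) : Prop :=
  f 0 = 0 ∧ ∀ n, f (n + 1) = n + 1 - f^[k + 1] n

/-- The upper adjoint of the Hofstadter function `f` with `k + 1` nested calls. -/
def hofstadterAdjoint (k : ℕ) (f : ℕ → ℕ) (n : ℕ) : ℕ :=
  n + f^[k] n

theorem iterate_le_of_le_self {f : ℕ → ℕ} (hf : ∀ n, f n ≤ n) (j n : ℕ) : f^[j] n ≤ n := by
  induction j with
  | zero => simp
  | succ j ih =>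
    rw [Function.iterate_succ_apply']
    exact (hf _).trans ih

/-- If `f` increases by `0` or `1` at each step below `N`, then so do its iterates. -/
theorem iterate_step_of_step {f : ℕ → ℕ} (hf : ∀ n, f n ≤ n) {N : ℕ}
    (h : ∀ i < N, f i ≤ f (i + 1) ∧ f (i + 1) ≤ f i + 1) (j i : ℕ) (hi : i < N) :
    f^[j] i ≤ f^[j] (i + 1) ∧ f^[j] (i + 1) ≤ f^[j] i + 1 := by
  induction j with
  | zero => simp
  | succ j ih =>
    simp only [Function.iterate_succ_apply']
    obtain hj | hj : f^[j] (i + 1) = f^[j] i ∨ f^[j] (i + 1) = f^[j] i + 1 := by omega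
    · simp [hj]
    · rw [hj]
      exact h _ ((iterate_le_of_le_self hf j i).trans_lt hi)

namespace IsHofstadter

variable {k : ℕ} {f g : ℕ → ℕ}

theorem le_self (hf : IsHofstadter k f) (n : ℕ) : f n ≤ n := by
  cases n with
  | zero => simp [hf.1]
  | succ n => simp [hf.2]

theorem step (hf : IsHofstadter k f) (n : ℕ) : f n ≤ f (n + 1) ∧ f (n + 1) ≤ f n + 1 := by
  induction n using Nat.strong_induction_on with
  | _ n ih =>
    cases n with
    | zero => simp [hf.1, hf.2]
    | succ n =>
      have h := iterate_step_of_step hf.le_self ih (k + 1) n n.lt_succ_self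
      have h' := iterate_le_of_le_self hf.le_self (k + 1) n
      rw [hf.2 (n + 1), hf.2 n]
      omega

theorem iterate_step (hf : IsHofstadter k f) (j n : ℕ) :
    f^[j] n ≤ f^[j] (n + 1) ∧ f^[j] (n + 1) ≤ f^[j] n + 1 :=
  iterate_step_of_step hf.le_self (fun i _ => hf.step i) j n n.lt_succ_self

theorem monotone (hf : IsHofstadter k f) : Monotone f :=
  monotone_nat_of_le_succ fun n => (hf.step n).1

theorem iterate_of_le_one (hf : IsHofstadter k f) {n : ℕ} (hn : n ≤ 1) (j : ℕ) :
    f^[j] n = n := by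
  have h0 (i : ℕ) : f^[i] 0 = 0 := Function.iterate_fixed hf.1 i
  obtain rfl | rfl : n = 0 ∨ n = 1 := by omega
  · exact h0 j
  · exact Function.iterate_fixed (by simp [hf.2, h0]) j

theorem lt_self (hf : IsHofstadter k f) {n : ℕ} (hn : 2 ≤ n) : f n < n := by
  obtain ⟨n, rfl⟩ : ∃ m, n = m + 1 := ⟨n - 1, by omega⟩
  have h := hf.monotone.iterate (k + 1) (show 1 ≤ n by omega)
  rw [hf.iterate_of_le_one le_rfl] at h
  rw [hf.2]
  omega

theorem iterate_lt_self (hf : IsHofstadter k f) {n : ℕ} (hn : 2 ≤ n) (j : ℕ) :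
    f^[j + 1] n < n := by
  rw [Function.iterate_succ_apply]
  exact (iterate_le_of_le_self hf.le_self j _).trans_lt (hf.lt_self hn)

theorem apply_adjoint_succ (hf : IsHofstadter k f) {n : ℕ}
    (h : f (hofstadterAdjoint k f n) = n) : f (hofstadterAdjoint k f n + 1) = n + 1 := by
  rw [hf.2, Function.iterate_succ_apply, h, hofstadterAdjoint]
  omega

theorem apply_adjoint (hf : IsHofstadter k f) (n : ℕ) : f (hofstadterAdjoint k f n) = n := by
  induction n with
  | zero => simp [hofstadterAdjoint, hf.iterate_of_le_one, hf.1]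
  | succ n ih =>
    have h := hf.apply_adjoint_succ ih
    obtain hk | hk : f^[k] (n + 1) = f^[k] n ∨ f^[k] (n + 1) = f^[k] n + 1 := by
      have := hf.iterate_step k n
      omega
    · rwa [show hofstadterAdjoint k f (n + 1) = hofstadterAdjoint k f n + 1 by
        simp only [hofstadterAdjoint]; omega]
    · rw [show hofstadterAdjoint k f (n + 1) = hofstadterAdjoint k f n + 1 + 1 by
        simp only [hofstadterAdjoint]; omega, hf.2, Function.iterate_succ_apply, h, hk,
        hofstadterAdjoint]
      omega

theorem galoisConnection (hf : IsHofstadter k f) :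
    GaloisConnection f (hofstadterAdjoint k f) := by
  intro n m
  constructor
  · intro h
    by_contra! hlt
    have := hf.monotone (Nat.succ_le_of_lt hlt)
    rw [Nat.succ_eq_add_one, hf.apply_adjoint_succ (hf.apply_adjoint m)] at this
    omega
  · intro h
    simpa [hf.apply_adjoint] using hf.monotone h

theorem iterate_le_iff (hf : IsHofstadter k f) (j n m : ℕ) :
    f^[j] n ≤ m ↔ n ≤ (hofstadterAdjoint k f)^[j] m := by
  induction j generalizing m with
  | zero => rfl
  | succ j ih =>
    rw [Function.iterate_succ_apply', Function.iterate_succ_apply, hf.galoisConnection, ih]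

theorem adjoint_iterate_succ (hf : IsHofstadter k f) {j : ℕ} (hj : j ≤ k) (n : ℕ) :
    (hofstadterAdjoint k f)^[j + 1] n = (hofstadterAdjoint k f)^[j] n + f^[k - j] n := by
  have h : f^[j] ((hofstadterAdjoint k f)^[j] n) = n :=
    Function.LeftInverse.iterate hf.apply_adjoint j n
  rw [Function.iterate_succ_apply']
  generalize (hofstadterAdjoint k f)^[j] n = a at h
  rw [← h, ← Function.iterate_add_apply, Nat.sub_add_cancel hj, hofstadterAdjoint]

theorem adjoint_iterate_le (hf : IsHofstadter k f) (hg : IsHofstadter (k + 1) g) {m : ℕ}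
    (h : ∀ j ≤ k, g^[j + 1] m ≤ f^[j] m) {j : ℕ} (hj : j ≤ k + 1) :
    (hofstadterAdjoint (k + 1) g)^[j] m ≤ (hofstadterAdjoint k f)^[j] m := by
  induction j with
  | zero => simp
  | succ j ih =>
    rw [hf.adjoint_iterate_succ (by omega), hg.adjoint_iterate_succ (by omega),
      Nat.sub_add_comm (by omega)]
    exact add_le_add (ih (by omega)) (h _ (by omega))

theorem adjoint_iterate_le_succ (hf : IsHofstadter k f) (hg : IsHofstadter (k + 1) g) {m : ℕ}
    (h : ∀ j ≤ k, f^[j] m ≤ g^[j] m) {j : ℕ} (hj : j ≤ k + 1) :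
    (hofstadterAdjoint k f)^[j] m ≤ (hofstadterAdjoint (k + 1) g)^[j + 1] m := by
  induction j with
  | zero => simp [hofstadterAdjoint]
  | succ j ih =>
    rw [hf.adjoint_iterate_succ (by omega), hg.adjoint_iterate_succ (by omega),
      Nat.add_sub_add_right]
    exact add_le_add (ih (by omega)) (h _ (by omega))

/-- The two comparisons feed each other through the adjoints, so they are proved together. -/
theorem iterate_le_and_iterate_succ_le (hf : IsHofstadter k f) (hg : IsHofstadter (k + 1) g)
    (n : ℕ) : ∀ j ≤ k + 1, f^[j] n ≤ g^[j] n ∧ g^[j + 1] n ≤ f^[j] n := by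
  induction n using Nat.strong_induction_on with
  | _ n ih =>
    intro j hj
    obtain hn | hn : n ≤ 1 ∨ 2 ≤ n := by omega
    · simp only [hf.iterate_of_le_one hn, hg.iterate_of_le_one hn, le_refl, and_self]
    cases j with
    | zero => exact ⟨le_rfl, hg.le_self n⟩
    | succ j =>
      constructor
      · have hm := hg.iterate_lt_self hn j
        exact (hf.iterate_le_iff _ _ _).2 <| ((hg.iterate_le_iff _ _ _).1 le_rfl).trans <|
          hf.adjoint_iterate_le hg (fun i hi => (ih _ hm i (by omega)).2) hj
      · have hm := hf.iterate_lt_self hn j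
        exact (hg.iterate_le_iff _ _ _).2 <| ((hf.iterate_le_iff _ _ _).1 le_rfl).trans <|
          hf.adjoint_iterate_le_succ hg (fun i hi => (ih _ hm i (by omega)).1) hj

theorem le_of_succ (hf : IsHofstadter k f) (hg : IsHofstadter (k + 1) g) : f ≤ g :=
  fun n => (hf.iterate_le_and_iterate_succ_le hg n 1 (by omega)).1

end IsHofstadter

/-- Monotonicity of the Hofstadter family in the parameter k: F_k^j(n) ≤ F_{k+1}^j(n),
in particular F_k(n) ≤ F_{k+1}(n). -/
theorem stmt16 (F : ℕ → ℕ → ℕ)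
    (hF : ∀ k, 1 ≤ k → F k 0 = 0 ∧ ∀ n, 1 ≤ n → F k n = n - (F k)^[k] (n - 1))
    (j k : ℕ) (hk : 1 ≤ k) (n : ℕ) :
    (F k)^[j] n ≤ (F (k + 1))^[j] n ∧ F k n ≤ F (k + 1) n := by
  have hH (i : ℕ) : IsHofstadter i (F (i + 1)) :=
    ⟨(hF _ (by omega)).1, fun m => (hF (i + 1) (by omega)).2 (m + 1) (by omega)⟩
  obtain ⟨k, rfl⟩ : ∃ i, k = i + 1 := ⟨k - 1, by omega⟩
  have hle := (hH k).le_of_succ (hH (k + 1))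
  exact ⟨(hH k).monotone.iterate_le_of_le hle j n, hle n⟩
end
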